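/- arXiv:2412.00565 — 2 statements merged into one kernel-verified Lean document; each statement's English description precedes it below -/
import Mathlib

section
/- Let V be a variety such that no algebra in V has a nontrivial abelian congruence (i.e., for every A ∈ V, the only abelian congruence on A is the equality relation). Then no algebra in V has a nontrivial abelian tolerance (for every A ∈ V, the only abelian tolerance on A is the equality relation). -/
open FirstOrder.Language FirstOrder.Language.Structure

universe u v w

/-- A binary relation on `A` is compatible with all (interpreted) operations of the
`L`-structure `A`. -/
def Compatible (L : FirstOrder.Language.{u, v}) (A : Type w) [L.Structure A]
    (T : A → A → Prop) : Prop :=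
  ∀ (n : ℕ) (f : L.Functions n) (a b : Fin n → A),
    (∀ i, T (a i) (b i)) → T (funMap f a) (funMap f b)

/-- A tolerance on `A`: a reflexive, symmetric, compatible binary relation. -/
def IsTolerance (L : FirstOrder.Language.{u, v}) (A : Type w) [L.Structure A]
    (T : A → A → Prop) : Prop :=
  Reflexive T ∧ Symmetric T ∧ Compatible L A T

/-- A congruence on `A`: a transitive tolerance. -/
def IsCongruence (L : FirstOrder.Language.{u, v}) (A : Type w) [L.Structure A]
    (T : A → A → Prop) : Prop :=
  IsTolerance L A T ∧ Transitive T

/-- The centralizer condition `C(S, T; δ)`: for every term `t(x, y₁, …, yₙ)`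
(variable `0` playing the role of `x`), every `(a, b) ∈ S` and all pairs
`(uᵢ, vᵢ) ∈ T`, if `(t(a, ū), t(a, v̄)) ∈ δ` then `(t(b, ū), t(b, v̄)) ∈ δ`. -/
def Centralizes (L : FirstOrder.Language.{u, v}) (A : Type w) [L.Structure A]
    (S T δ : A → A → Prop) : Prop :=
  ∀ (n : ℕ) (t : L.Term (Fin (n + 1))) (a b : A), S a b →
    ∀ u v : Fin n → A, (∀ i, T (u i) (v i)) →
      (δ (t.realize (Fin.cons a u)) (t.realize (Fin.cons a v)) →
        δ (t.realize (Fin.cons b u)) (t.realize (Fin.cons b v)))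

/-- The algebra `A` satisfies every equation in the set `E` under every assignment:
membership in the variety axiomatized by `E`. -/
def SatisfiesEqs (L : FirstOrder.Language.{u, v}) (A : Type w) [L.Structure A]
    (E : Set (Σ n : ℕ, L.Term (Fin n) × L.Term (Fin n))) : Prop :=
  ∀ e ∈ E, ∀ val : Fin e.1 → A, e.2.1.realize val = e.2.2.realize val

/-- `wt` is a weak difference term for the variety axiomatized by `E`: for every
algebra `A` in the variety, every abelian congruence `α` on `A`, and every
`(a, b) ∈ α`, `wt(a, a, b) = b` and `wt(b, a, a) = b`. -/
def IsWeakDifferenceTerm (L : FirstOrder.Language.{u, v})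
    (E : Set (Σ n : ℕ, L.Term (Fin n) × L.Term (Fin n))) (wt : L.Term (Fin 3)) : Prop :=
  ∀ (A : Type w) [L.Structure A], SatisfiesEqs L A E →
    ∀ α : A → A → Prop, IsCongruence L A α → Centralizes L A α α Eq →
      ∀ a b : A, α a b → wt.realize ![a, a, b] = b ∧ wt.realize ![b, a, a] = b

/-- The variety axiomatized by `E` has a Taylor term: an idempotent term
`t(x₁, …, xₙ)`, `n ≥ 1`, such that for each `i` the variety satisfies an identity
`t(w₁, …, wₙ) ≈ t(z₁, …, zₙ)` with `wᵢ ≠ zᵢ` (variables indexed by `ℕ`). -/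
def HasTaylorTerm (L : FirstOrder.Language.{u, v})
    (E : Set (Σ n : ℕ, L.Term (Fin n) × L.Term (Fin n))) : Prop :=
  ∃ (n : ℕ) (t : L.Term (Fin n)), 0 < n ∧
    (∀ (A : Type w) [L.Structure A], SatisfiesEqs L A E →
      ∀ a : A, t.realize (fun _ => a) = a) ∧
    (∀ i : Fin n, ∃ wv zv : Fin n → ℕ, wv i ≠ zv i ∧
      ∀ (A : Type w) [L.Structure A], SatisfiesEqs L A E →
        ∀ val : ℕ → A, t.realize (val ∘ wv) = t.realize (val ∘ zv))

section Polynomials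

variable (L : FirstOrder.Language.{u, v}) {A : Type w} [L.Structure A]

/-- `PolyPair L p q x y`: some unary polynomial of `A` sends `p` to `x` and `q` to `y`. -/
inductive PolyPair (p q : A) : A → A → Prop
  | base : PolyPair p q p q
  | refl (c : A) : PolyPair p q c c
  | op {n : ℕ} (f : L.Functions n) (x y : Fin n → A) :
      (∀ i, PolyPair p q (x i) (y i)) → PolyPair p q (funMap f x) (funMap f y)

/-- `TermMatrix L S p q w x y z`: for some term `t` and some `S`-related tuples `u`, `v`,
`w = t(p, u)`, `x = t(p, v)`, `y = t(q, u)` and `z = t(q, v)`. -/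
inductive TermMatrix (S : A → A → Prop) (p q : A) : A → A → A → A → Prop
  | base : TermMatrix S p q p p q q
  | param (u v : A) : S u v → TermMatrix S p q u v u v
  | op {n : ℕ} (f : L.Functions n) (w x y z : Fin n → A) :
      (∀ i, TermMatrix S p q (w i) (x i) (y i) (z i)) →
        TermMatrix S p q (funMap f w) (funMap f x) (funMap f y) (funMap f z)

/-- The set of pairs `(p, q)` for which the centralizer condition `C({(p, q), (q, p)}, S; δ)`
holds. -/
def Centralizer (S δ : A → A → Prop) (p q : A) : Prop :=
  ∀ w x y z, TermMatrix L S p q w x y z → (δ w x ↔ δ y z)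

/-- The largest congruence contained in `α` all of whose pairs inside `W` lie in `R`. -/
def LargestBelow (α R : A → A → Prop) (W : A → Prop) (p q : A) : Prop :=
  α p q ∧ ∀ x y, PolyPair L p q x y → W x → R x y

variable {L}

namespace PolyPair

theorem symm {p q x y : A} (h : PolyPair L p q x y) : PolyPair L q p y x := by
  induction h with
  | base => exact base
  | refl c => exact refl c
  | op f x y _ ih => exact op f _ _ ih

theorem comp {p q p' q' x y : A} (h : PolyPair L p q p' q') (h' : PolyPair L p' q' x y) :
    PolyPair L p q x y := by
  induction h' with
  | base => exact h
  | refl c => exact refl c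
  | op f x y _ ih => exact op f _ _ ih

theorem split {p q x z : A} (h : PolyPair L p q x z) (r : A) :
    ∃ y, PolyPair L p r x y ∧ PolyPair L r q y z := by
  induction h with
  | base => exact ⟨r, base, base⟩
  | refl c => exact ⟨c, refl c, refl c⟩
  | op f x z _ ih =>
    choose y h1 h2 using ih
    exact ⟨funMap f y, op f _ _ h1, op f _ _ h2⟩

theorem rel {T : A → A → Prop} (hT : IsTolerance L A T) {p q x y : A} (hpq : T p q)
    (h : PolyPair L p q x y) : T x y := by
  induction h with
  | base => exact hpq
  | refl c => exact hT.1 c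
  | op f x y _ ih => exact hT.2.2 _ f _ _ ih

/-- A polynomial applied to the pair `(p, q)` can be applied to any pair `(p', q')`, and the
results are `T`-related if `p T p'` and `q T q'`. -/
theorem transport {T : A → A → Prop} (hT : IsTolerance L A T) {p q p' q' x y : A}
    (hp : T p p') (hq : T q q') (h : PolyPair L p q x y) :
    ∃ x' y', PolyPair L p' q' x' y' ∧ T x x' ∧ T y y' := by
  induction h with
  | base => exact ⟨p', q', base, hp, hq⟩
  | refl c => exact ⟨c, c, refl c, hT.1 c, hT.1 c⟩
  | op f x y _ ih =>
    choose x' y' h h1 h2 using ih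
    exact ⟨funMap f x', funMap f y', op f _ _ h, hT.2.2 _ f _ _ h1, hT.2.2 _ f _ _ h2⟩

end PolyPair

/-- An equivalence relation preserved by all unary polynomials is a congruence. -/
theorem isCongruence_of_polyPair {r : A → A → Prop} (hr : Reflexive r) (hs : Symmetric r)
    (ht : Transitive r) (h : ∀ p q x y, r p q → PolyPair L p q x y → r x y) :
    IsCongruence L A r := by
  classical
  refine ⟨⟨hr, hs, fun n f a b hab => ?_⟩, ht⟩
  have key : ∀ s : Finset (Fin n), r (funMap f a) (funMap f (s.piecewise b a)) := by
    intro s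
    induction s using Finset.induction_on with
    | empty => simpa using hr _
    | insert j s hj ih =>
      refine ht ih (h _ _ _ _ (hab j) (.op f _ _ fun i => ?_))
      rw [Finset.piecewise_insert]
      by_cases hij : i = j
      · subst hij
        simpa [hj] using .base
      · simpa [hij] using .refl _
  simpa using key Finset.univ

namespace TermMatrix

variable {S : A → A → Prop}

theorem symm {p q w x y z : A} (h : TermMatrix L S p q w x y z) :
    TermMatrix L S q p y z w x := by
  induction h with
  | base => exact base
  | param u v h => exact param u v h
  | op f w x y z _ ih => exact op f _ _ _ _ ih

theorem eq_of_self {p w x y z : A} (h : TermMatrix L S p p w x y z) : w = y ∧ x = z := by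
  induction h with
  | base => exact ⟨rfl, rfl⟩
  | param u v h => exact ⟨rfl, rfl⟩
  | op f w x y z _ ih =>
    exact ⟨congrArg _ (funext fun i => (ih i).1), congrArg _ (funext fun i => (ih i).2)⟩

theorem split {p q w x y z : A} (h : TermMatrix L S p q w x y z) (r : A) :
    ∃ w' x', TermMatrix L S p r w x w' x' ∧ TermMatrix L S r q w' x' y z := by
  induction h with
  | base => exact ⟨r, r, base, base⟩
  | param u v h => exact ⟨u, v, param u v h, param u v h⟩
  | op f w x y z _ ih =>
    choose w' x' h1 h2 using ih
    exact ⟨funMap f w', funMap f x', op f _ _ _ _ h1, op f _ _ _ _ h2⟩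

theorem comp (hS : Reflexive S) {p q p' q' w x y z : A} (h : PolyPair L p q p' q')
    (h' : TermMatrix L S p' q' w x y z) : TermMatrix L S p q w x y z := by
  induction h' with
  | base =>
    induction h with
    | base => exact base
    | refl c => exact param c c (hS c)
    | op f x y _ ih => exact op f _ _ _ _ ih
  | param u v h => exact param u v h
  | op f w x y z _ ih => exact op f _ _ _ _ ih

theorem rel_columns {T : A → A → Prop} (hT : IsTolerance L A T) {p q w x y z : A} (hpq : T p q)
    (h : TermMatrix L S p q w x y z) : T w y ∧ T x z := by
  induction h with
  | base => exact ⟨hpq, hpq⟩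
  | param u v h => exact ⟨hT.1 u, hT.1 v⟩
  | op f w x y z _ ih =>
    exact ⟨hT.2.2 _ f _ _ fun i => (ih i).1, hT.2.2 _ f _ _ fun i => (ih i).2⟩

theorem rel_rows (hS : IsTolerance L A S) {p q w x y z : A}
    (h : TermMatrix L S p q w x y z) : S w x ∧ S y z := by
  induction h with
  | base => exact ⟨hS.1 p, hS.1 q⟩
  | param u v h => exact ⟨h, h⟩
  | op f w x y z _ ih =>
    exact ⟨hS.2.2 _ f _ _ fun i => (ih i).1, hS.2.2 _ f _ _ fun i => (ih i).2⟩

theorem realize {n : ℕ} (t : L.Term (Fin (n + 1))) (p q : A) (u v : Fin n → A)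
    (h : ∀ i, S (u i) (v i)) :
    TermMatrix L S p q (t.realize (Fin.cons p u)) (t.realize (Fin.cons p v))
      (t.realize (Fin.cons q u)) (t.realize (Fin.cons q v)) := by
  induction t with
  | var i =>
    refine Fin.cases ?_ (fun i => ?_) i
    · exact base
    · exact param _ _ (h i)
  | func f ts ih => exact op f _ _ _ _ ih

end TermMatrix

theorem isCongruence_centralizer {S δ : A → A → Prop} (hS : Reflexive S) :
    IsCongruence L A (Centralizer L S δ) := by
  refine isCongruence_of_polyPair ?_ ?_ ?_ ?_
  · intro p w x y z h
    obtain ⟨rfl, rfl⟩ := h.eq_of_self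
    rfl
  · exact fun p q h w x y z hm => (h _ _ _ _ hm.symm).symm
  · intro p q r h h' w x y z hm
    obtain ⟨w', x', h1, h2⟩ := hm.split q
    exact (h _ _ _ _ h1).trans (h' _ _ _ _ h2)
  · exact fun p q p' q' h hp w x y z hm => h _ _ _ _ (.comp hS hp hm)

theorem isCongruence_inf {α β : A → A → Prop} (hα : IsCongruence L A α)
    (hβ : IsCongruence L A β) : IsCongruence L A fun p q => α p q ∧ β p q :=
  ⟨⟨fun a => ⟨hα.1.1 a, hβ.1.1 a⟩, fun _ _ h => ⟨hα.1.2.1 h.1, hβ.1.2.1 h.2⟩,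
    fun n f a b h => ⟨hα.1.2.2 n f a b fun i => (h i).1, hβ.1.2.2 n f a b fun i => (h i).2⟩⟩,
    fun _ _ _ h h' => ⟨hα.2 h.1 h'.1, hβ.2 h.2 h'.2⟩⟩

theorem isCongruence_largestBelow {α R : A → A → Prop} {W : A → Prop}
    (hα : IsCongruence L A α) (hW : ∀ x y, α x y → W x → W y)
    (hR : Equivalence R) : IsCongruence L A (LargestBelow L α R W) := by
  refine isCongruence_of_polyPair ?_ ?_ ?_ ?_
  · refine fun p => ⟨hα.1.1 p, fun x y h _ => ?_⟩
    have : x = y := PolyPair.rel (T := Eq)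
      ⟨fun _ => rfl, fun _ _ => Eq.symm, fun n f a b h => congrArg _ (funext h)⟩ rfl h
    exact this ▸ hR.refl x
  · refine fun p q h => ⟨hα.1.2.1 h.1, fun x y hp hx => ?_⟩
    exact hR.symm (h.2 _ _ hp.symm (hW _ _ (hp.rel hα.1 (hα.1.2.1 h.1)) hx))
  · refine fun p q r h h' => ⟨hα.2 h.1 h'.1, fun x z hp hx => ?_⟩
    obtain ⟨y, h1, h2⟩ := hp.split q
    exact hR.trans (h.2 _ _ h1 hx) (h'.2 _ _ h2 (hW _ _ (h1.rel hα.1 h.1) hx))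
  · exact fun p q x y h hp => ⟨hp.rel hα.1 h.1, fun x' y' hp' => h.2 _ _ (hp.comp hp')⟩

/-- Pairs of a congruence `β` centralize `α` modulo `LargestBelow L α R W`, provided that on
`α`-pairs inside `W` the relation `R` is invariant under `β`. -/
theorem centralizer_of_invariant {α β R : A → A → Prop} {W : A → Prop}
    (hα : IsCongruence L A α) (hβ : IsCongruence L A β) (hWβ : ∀ x y, β x y → W x → W y)
    (hR : ∀ x y x' y', α x y → α x' y' → β x x' → β y y' → W x → W x' → R x y → R x' y')
    {p q : A} (hpq : β p q) : Centralizer L α (LargestBelow L α R W) p q := by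
  have key : ∀ p q, β p q → ∀ w x y z, TermMatrix L α p q w x y z →
      LargestBelow L α R W w x → LargestBelow L α R W y z := by
    intro p q hpq w x y z hm h
    have hyz := (hm.rel_rows hα.1).2
    obtain ⟨hwy, hxz⟩ := hm.rel_columns hβ.1 hpq
    refine ⟨hyz, fun y' z' hp hy' => ?_⟩
    obtain ⟨w', x', hp', hw, hx⟩ :=
      hp.transport hβ.1 (hβ.1.2.1 hwy) (hβ.1.2.1 hxz)
    have hw' := hWβ _ _ hw hy'
    exact hR _ _ _ _ (hp'.rel hα.1 h.1) (hp.rel hα.1 hyz) (hβ.1.2.1 hw) (hβ.1.2.1 hx) hw' hy'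
      (h.2 _ _ hp' hw')
  exact fun w x y z hm => ⟨key p q hpq _ _ _ _ hm, key q p (hβ.1.2.1 hpq) _ _ _ _ hm.symm⟩

end Polynomials

section Quotient

variable {L : FirstOrder.Language.{u, v}} {A : Type w} [L.Structure A]

/-- The quotient algebra modulo an equivalence relation, with operations computed on
representatives. -/
noncomputable abbrev quotientAlgebra (s : Setoid A) : L.Structure (Quotient s) where
  funMap f x := Quotient.mk s (funMap f fun i => (x i).out)
  RelMap _ _ := False

theorem realize_quotientAlgebra {s : Setoid A} (hs : IsCongruence L A s.r) {ι : Type*}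
    (t : L.Term ι) (x : ι → A) :
    @FirstOrder.Language.Term.realize L _ (quotientAlgebra s) _ (fun i => Quotient.mk s (x i)) t =
      Quotient.mk s (t.realize x) := by
  let := quotientAlgebra (L := L) s
  induction t with
  | var i => rfl
  | func f ts ih =>
    rw [FirstOrder.Language.Term.realize_func, FirstOrder.Language.Term.realize_func]
    refine Quotient.sound (hs.1.2.2 _ f _ _ fun i => ?_)
    beta_reduce
    rw [ih i]
    exact Quotient.mk_out (s := s) _

/-- If abelian congruences are trivial throughout the variety, then a congruence `ε ≥ δ` that is
abelian modulo `δ` is contained in `δ`. -/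
theorem le_of_abelian_modulo
    {E : Set (Σ n : ℕ, L.Term (Fin n) × L.Term (Fin n))}
    (h : ∀ (A : Type w) [L.Structure A], SatisfiesEqs L A E →
      ∀ α : A → A → Prop, IsCongruence L A α → Centralizes L A α α Eq →
        α = fun a b => a = b)
    (hA : SatisfiesEqs L A E) {δ ε : A → A → Prop} (hδ : IsCongruence L A δ)
    (hε : IsCongruence L A ε) (hle : ∀ p q, δ p q → ε p q) (hab : Centralizes L A ε ε δ)
    {p q : A} (hpq : ε p q) : δ p q := by
  let s : Setoid A := ⟨δ, fun a => hδ.1.1 a, fun h => hδ.1.2.1 h, fun h h' => hδ.2 h h'⟩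
  let := quotientAlgebra (L := L) s
  have hs : IsCongruence L A s.r := hδ
  let ε' : Quotient s → Quotient s → Prop := fun x y => ε x.out y.out
  have hout : ∀ a, δ (Quotient.mk s a).out a := fun a => Quotient.mk_out (s := s) a
  have hε' : ∀ a b, ε a b → ε' (Quotient.mk s a) (Quotient.mk s b) := fun a b hab =>
    hε.2 (hε.2 (hle _ _ (hout a)) hab) (hε.1.2.1 (hle _ _ (hout b)))
  have hcongr : IsCongruence L (Quotient s) ε' :=
    ⟨⟨fun x => hε.1.1 _, fun _ _ h => hε.1.2.1 h,
      fun n f a b h => hε' _ _ (hε.1.2.2 n f _ _ h)⟩, fun _ _ _ h h' => hε.2 h h'⟩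
  have hrealize : ∀ {ι : Type} (t : L.Term ι) (x : ι → Quotient s),
      t.realize x = Quotient.mk s (t.realize fun i => (x i).out) := by
    intro ι t x
    rw [← realize_quotientAlgebra hs]
    simp
  have hcons : ∀ {n : ℕ} (a : Quotient s) (u : Fin n → Quotient s),
      (fun i => (Fin.cons (α := fun _ => Quotient s) a u i).out) =
        Fin.cons (α := fun _ => A) a.out fun i => (u i).out := by
    intro n a u
    funext i
    refine Fin.cases rfl (fun i => rfl) i
  have heqs : SatisfiesEqs L (Quotient s) E := by
    intro e he val
    rw [hrealize, hrealize, hA e he]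
  have hcent : Centralizes L (Quotient s) ε' ε' Eq := by
    intro n t a b hab' u v huv heq
    rw [hrealize, hrealize, hcons, hcons] at heq ⊢
    exact Quotient.sound (hab n t _ _ hab' _ _ huv (Quotient.exact heq))
  have := hε' _ _ hpq
  rw [h (Quotient s) heqs ε' hcongr hcent] at this
  exact Quotient.exact this

end Quotient

section TermCondition

variable {L : FirstOrder.Language.{u, v}} {A : Type w} [L.Structure A] {T : A → A → Prop}

theorem Centralizes.realize_update {ι : Type*} [Fintype ι] [DecidableEq ι]
    (hab : Centralizes L A T T Eq) (t : L.Term ι) (i₀ : ι) {a b : A} (h : T a b) {x y : ι → A}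
    (hxy : ∀ i, T (x i) (y i))
    (heq : t.realize (Function.update x i₀ a) = t.realize (Function.update y i₀ a)) :
    t.realize (Function.update x i₀ b) = t.realize (Function.update y i₀ b) := by
  let e := Fintype.equivFin ι
  let t' : L.Term (Fin (Fintype.card ι + 1)) :=
    t.relabel fun j => if j = i₀ then 0 else (e j).succ
  have ht' : ∀ (c : A) (z : ι → A),
      t'.realize (Fin.cons c (z ∘ e.symm)) = t.realize (Function.update z i₀ c) := by
    intro c z
    rw [FirstOrder.Language.Term.realize_relabel]
    congr 1
    funext j
    by_cases hj : j = i₀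
    · simp [hj]
    · simp [hj]
  rw [← ht', ← ht'] at heq ⊢
  exact hab _ t' a b h _ _ (fun i => hxy _) heq

/-- The term condition for an abelian tolerance, with several coordinates changed at once. -/
theorem Centralizes.realize_eq {ι : Type*} [Fintype ι]
    (hT : IsTolerance L A T) (hab : Centralizes L A T T Eq) (t : L.Term ι)
    {x y x' y' : ι → A} (heq : t.realize x = t.realize y) (hxy : ∀ i, T (x i) (y i))
    (h : ∀ i, (x i = y i ∧ x' i = y' i ∧ T (x i) (x' i)) ∨ (x' i = x i ∧ y' i = y i)) :
    t.realize x' = t.realize y' := by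
  classical
  have hxy' : ∀ i, T (x' i) (y' i) := by
    intro i
    rcases h i with ⟨-, h2, -⟩ | ⟨h1, h2⟩
    · rw [h2]
      exact hT.1 _
    · rw [h1, h2]
      exact hxy i
  have key : ∀ s : Finset ι, t.realize (s.piecewise x' x) = t.realize (s.piecewise y' y) := by
    intro s
    induction s using Finset.induction_on with
    | empty => simpa using heq
    | insert j s hj ih =>
      have hs : ∀ i, T (s.piecewise x' x i) (s.piecewise y' y i) := by
        intro i
        by_cases hi : i ∈ s
        · simpa [hi] using hxy' i
        · simpa [hi] using hxy i
      rw [Finset.piecewise_insert, Finset.piecewise_insert]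
      rcases h j with ⟨h1, h2, h3⟩ | ⟨h1, h2⟩
      · rw [← h2]
        refine hab.realize_update t j h3 hs ?_
        have e1 : Function.update (s.piecewise x' x) j (x j) = s.piecewise x' x := by
          simp [Function.update_eq_self_iff, hj]
        have e2 : Function.update (s.piecewise y' y) j (x j) = s.piecewise y' y := by
          simp [Function.update_eq_self_iff, hj, h1]
        rw [e1, e2, ih]
      · have e1 : Function.update (s.piecewise x' x) j (x' j) = s.piecewise x' x := by
          simp [Function.update_eq_self_iff, hj, h1]
        have e2 : Function.update (s.piecewise y' y) j (y' j) = s.piecewise y' y := by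
          simp [Function.update_eq_self_iff, hj, h2]
        rw [e1, e2, ih]
  simpa using key Finset.univ

/-- Two ternary idempotent terms that agree at `(a, b, a)` and `(a, a, b)`, where `(a, b)` lies
in an abelian tolerance, agree at `(a, b, b)`. -/
theorem realize_eq_of_two_corners (hT : IsTolerance L A T) (hab : Centralizes L A T T Eq)
    {f g : L.Term (Fin 3)} (hf : ∀ c : A, f.realize ![c, c, c] = c)
    (hg : ∀ c : A, g.realize ![c, c, c] = c) {a b : A} (h : T a b)
    (h1 : f.realize ![a, b, a] = g.realize ![a, b, a])
    (h2 : f.realize ![a, a, b] = g.realize ![a, a, b]) :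
    f.realize ![a, b, b] = g.realize ![a, b, b] := by
  let t : L.Term (Fin 3 × Fin 3) := f.subst fun j => g.relabel fun k => (j, k)
  have ht : ∀ m : Matrix (Fin 3) (Fin 3) A, t.realize (fun i => m i.1 i.2) =
      f.realize fun j => g.realize (m j) := by
    intro m
    simp only [t, FirstOrder.Language.Term.realize_subst,
      FirstOrder.Language.Term.realize_relabel]
    rfl
  have hrow : ∀ c d e : A,
      t.realize (fun i => !![c, c, c; d, d, d; e, e, e] i.1 i.2) = f.realize ![c, d, e] := by
    intro c d e
    rw [ht]
    congr 1
    funext j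
    fin_cases j
    · exact hg c
    · exact hg d
    · exact hg e
  have hcol : ∀ c d e : A,
      t.realize (fun i => !![c, d, e; c, d, e; c, d, e] i.1 i.2) = g.realize ![c, d, e] := by
    intro c d e
    rw [ht]
    refine Eq.trans ?_ (hf _)
    congr 1
    funext j
    fin_cases j <;> rfl
  have haa := hT.1 a
  have hbb := hT.1 b
  have hba := hT.2.1 h
  have s1 : t.realize (fun i => !![a, a, a; b, b, b; b, a, b] i.1 i.2) =
      t.realize (fun i => !![a, b, a; a, b, a; b, b, b] i.1 i.2) := by
    refine hab.realize_eq hT t ((hrow a b a).trans (h1.trans (hcol a b a).symm)) ?_ ?_ <;>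
      rintro ⟨j, k⟩ <;> fin_cases j <;> fin_cases k <;> simp [*]
  have s2 : t.realize (fun i => !![a, b, a; a, b, a; b, b, b] i.1 i.2) =
      t.realize (fun i => !![a, b, b; a, b, b; a, a, b] i.1 i.2) := by
    refine hab.realize_eq hT t ((hrow a a b).trans (h2.trans (hcol a a b).symm)) ?_ ?_ <;>
      rintro ⟨j, k⟩ <;> fin_cases j <;> fin_cases k <;> simp [*]
  rw [← hrow, ← hcol]
  refine hab.realize_eq hT t (s1.trans s2) ?_ ?_ <;>
    rintro ⟨j, k⟩ <;> fin_cases j <;> fin_cases k <;> simp [*]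

theorem realize_eq_of_two_corners_rev (hT : IsTolerance L A T) (hab : Centralizes L A T T Eq)
    {f g : L.Term (Fin 3)} (hf : ∀ c : A, f.realize ![c, c, c] = c)
    (hg : ∀ c : A, g.realize ![c, c, c] = c) {a b : A} (h : T a b)
    (h1 : f.realize ![b, a, b] = g.realize ![b, a, b])
    (h2 : f.realize ![a, b, b] = g.realize ![a, b, b]) :
    f.realize ![a, a, b] = g.realize ![a, a, b] := by
  have hrev : ∀ (t : L.Term (Fin 3)) (c d e : A),
      (t.relabel Fin.rev).realize ![c, d, e] = t.realize ![e, d, c] := by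
    intro t c d e
    rw [FirstOrder.Language.Term.realize_relabel]
    congr 1
    funext j
    fin_cases j <;> rfl
  have := realize_eq_of_two_corners (f := f.relabel Fin.rev) (g := g.relabel Fin.rev) hT hab
    (fun c => (hrev f c c c).trans (hf c)) (fun c => (hrev g c c c).trans (hg c)) (hT.2.1 h)
    (by rwa [hrev, hrev]) (by rwa [hrev, hrev])
  rwa [hrev, hrev] at this

end TermCondition

section TernaryTermOperations

variable (L : FirstOrder.Language.{u, v}) (A : Type w) [L.Structure A]

/-- The ternary term operations of `A`: the free algebra on three generators in the variety
generated by `A`. -/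
def TernaryTermOp : Type w :=
  {φ : (Fin 3 → A) → A // ∃ t : L.Term (Fin 3), ∀ x, φ x = t.realize x}

variable {L A}

namespace TernaryTermOp

/-- The operation induced by a term. -/
def ofTerm (t : L.Term (Fin 3)) : TernaryTermOp L A := ⟨fun x => t.realize x, t, fun _ => rfl⟩

instance : L.Structure (TernaryTermOp L A) where
  funMap f φ := ⟨fun x => funMap f fun i => (φ i).1 x, by
    choose t ht using fun i => (φ i).2
    exact ⟨.func f t, fun x => by simp [ht]⟩⟩
  RelMap _ _ := False

theorem realize_val {ι : Type*} (t : L.Term ι) (φ : ι → TernaryTermOp L A) (x : Fin 3 → A) :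
    (t.realize φ).1 x = t.realize fun i => (φ i).1 x := by
  induction t with
  | var i => rfl
  | func f ts ih => exact congrArg (funMap f) (funext ih)

theorem satisfiesEqs {E : Set (Σ n : ℕ, L.Term (Fin n) × L.Term (Fin n))}
    (hA : SatisfiesEqs L A E) : SatisfiesEqs L (TernaryTermOp L A) E := by
  intro e he val
  refine Subtype.ext (funext fun x => ?_)
  rw [realize_val, realize_val, hA e he]

/-- Agreement on a set of points is a congruence. -/
theorem isCongruence_agree {ι : Type*} (P : ι → Fin 3 → A) :
    IsCongruence L (TernaryTermOp L A) fun φ ψ => ∀ i, φ.1 (P i) = ψ.1 (P i) :=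
  ⟨⟨fun _ _ => rfl, fun _ _ h i => (h i).symm,
    fun _ f _ _ h i => congrArg (funMap f) (funext fun j => h j i)⟩,
    fun _ _ _ h h' i => (h i).trans (h' i)⟩

end TernaryTermOp

end TernaryTermOperations

/-- If no algebra of a variety has a nontrivial abelian congruence, then no algebra
of the variety has a nontrivial abelian tolerance. -/
theorem abelian_tolerance_trivial_of_abelian_congruence_trivial
    {L : FirstOrder.Language.{u, v}}
    (E : Set (Σ n : ℕ, L.Term (Fin n) × L.Term (Fin n)))
    (h : ∀ (A : Type w) [L.Structure A], SatisfiesEqs L A E →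
      ∀ α : A → A → Prop, IsCongruence L A α → Centralizes L A α α Eq →
        α = fun a b => a = b) :
    ∀ (A : Type w) [L.Structure A], SatisfiesEqs L A E →
      ∀ T : A → A → Prop, IsTolerance L A T → Centralizes L A T T Eq →
        T = fun a b => a = b := by
  intro A _ hA T hT hab
  funext a b
  refine propext ⟨fun hTab => ?_, fun hab => hab ▸ hT.1 a⟩
  let α : TernaryTermOp L A → TernaryTermOp L A → Prop :=
    fun φ ψ => ∀ i : A × A, φ.1 ![i.1, i.2, i.1] = ψ.1 ![i.1, i.2, i.1]
  let β : TernaryTermOp L A → TernaryTermOp L A → Prop :=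
    fun φ ψ => ∀ i : A × A, φ.1 ![i.1, i.1, i.2] = ψ.1 ![i.1, i.1, i.2]
  let γ : TernaryTermOp L A → TernaryTermOp L A → Prop :=
    fun φ ψ => ∀ i : A × A, φ.1 ![i.1, i.2, i.2] = ψ.1 ![i.1, i.2, i.2]
  let W : TernaryTermOp L A → Prop := fun φ => ∀ c, φ.1 ![c, c, c] = c
  let R : TernaryTermOp L A → TernaryTermOp L A → Prop :=
    fun φ ψ => φ.1 ![a, a, b] = ψ.1 ![a, a, b]
  have hα : IsCongruence L _ α := TernaryTermOp.isCongruence_agree _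
  have hβ : IsCongruence L _ β := TernaryTermOp.isCongruence_agree _
  have hγ : IsCongruence L _ γ := TernaryTermOp.isCongruence_agree _
  have hWα : ∀ φ ψ, α φ ψ → W φ → W ψ := fun φ ψ h hφ c => (h (c, c)).symm.trans (hφ c)
  have hWβ : ∀ φ ψ, β φ ψ → W φ → W ψ := fun φ ψ h hφ c => (h (c, c)).symm.trans (hφ c)
  have hWγ : ∀ φ ψ, γ φ ψ → W φ → W ψ := fun φ ψ h hφ c => (h (c, c)).symm.trans (hφ c)
  have hRiff : ∀ φ ψ, α φ ψ → W φ → (R φ ψ ↔ φ.1 ![a, b, b] = ψ.1 ![a, b, b]) := by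
    intro φ ψ hφψ hφ
    have hψ := hWα _ _ hφψ hφ
    obtain ⟨φ, f, hf⟩ := φ
    obtain ⟨ψ, g, hg⟩ := ψ
    simp only [α, W, R, hf, hg] at hφψ hφ hψ ⊢
    exact ⟨realize_eq_of_two_corners hT hab hφ hψ hTab (hφψ (a, b)),
      realize_eq_of_two_corners_rev hT hab hφ hψ hTab (hφψ (b, a))⟩
  let δ := LargestBelow L α R W
  have hδ : IsCongruence L _ δ :=
    isCongruence_largestBelow hα hWα ⟨fun _ => rfl, fun h => h.symm, fun h h' => h.trans h'⟩
  have hτ : IsCongruence L _ (Centralizer L α δ) := isCongruence_centralizer hα.1.1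
  have hβτ : ∀ φ ψ, β φ ψ → Centralizer L α δ φ ψ := fun φ ψ =>
    centralizer_of_invariant hα hβ hWβ fun _ _ _ _ _ _ hx hy _ _ h =>
      (hx (a, b)).symm.trans (h.trans (hy (a, b)))
  have hγτ : ∀ φ ψ, γ φ ψ → Centralizer L α δ φ ψ := fun φ ψ =>
    centralizer_of_invariant hα hγ hWγ fun _ _ _ _ hxy hxy' hx hy hW hW' h =>
      (hRiff _ _ hxy' hW').2 ((hx (a, b)).symm.trans (((hRiff _ _ hxy hW).1 h).trans (hy (a, b))))
  have hδτ : ∀ φ ψ, δ φ ψ → Centralizer L α δ φ ψ := by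
    intro φ ψ hφψ w x y z hm
    obtain ⟨hwy, hxz⟩ := hm.rel_columns hδ.1 hφψ
    exact ⟨fun h => hδ.2 (hδ.1.2.1 hwy) (hδ.2 h hxz),
      fun h => hδ.2 hwy (hδ.2 h (hδ.1.2.1 hxz))⟩
  have hle : ∀ φ ψ, α φ ψ ∧ Centralizer L α δ φ ψ → δ φ ψ := fun _ _ =>
    le_of_abelian_modulo h (TernaryTermOp.satisfiesEqs hA) hδ (isCongruence_inf hα hτ)
    (fun φ ψ h => ⟨h.1, hδτ _ _ h⟩)
    (fun n t φ ψ h u v huv => (h.2 _ _ _ _ (.realize t φ ψ u v fun i => (huv i).1)).1)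
  let X : Fin 3 → TernaryTermOp L A := fun i => .ofTerm (.var i)
  have h02 : δ (X 0) (X 2) := hle _ _
    ⟨fun _ => rfl, hτ.2 (hβτ (X 0) (X 1) fun _ => rfl) (hγτ (X 1) (X 2) fun _ => rfl)⟩
  exact h02.2 _ _ .base fun _ => rfl
end

section
/- Let A be an algebra and let β and δ be congruences on A such that C(β,β;δ) holds. Then C(δ∘β∘δ, δ∘β∘δ; δ) holds, where ∘ denotes composition of binary relations. -/
open FirstOrder.Language FirstOrder.Language.Structure

universe u v w

/-- Composition of binary relations: `(a, c) ∈ R ∘ S` iff there is `b` with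
`(a, b) ∈ R` and `(b, c) ∈ S`. -/
def RelComp {A : Type w} (R S : A → A → Prop) : A → A → Prop :=
  fun a c => ∃ b, R a b ∧ S b c

/-- A compatible relation is preserved by every term operation. -/
theorem Compatible.realize {L : FirstOrder.Language.{u, v}} {A : Type w} [L.Structure A]
    {T : A → A → Prop} (hT : Compatible L A T) {α : Type*} (t : L.Term α) {x y : α → A}
    (h : ∀ i, T (x i) (y i)) : T (t.realize x) (t.realize y) := by
  induction t with
  | var i => exact h i
  | func f ts ih => exact hT _ f _ _ ih

/-- If `β` and `δ` are congruences with `C(β, β; δ)`, then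
`C(δ ∘ β ∘ δ, δ ∘ β ∘ δ; δ)`. -/
theorem centralizes_comp_comp {L : FirstOrder.Language.{u, v}}
    {A : Type w} [L.Structure A] (β δ : A → A → Prop)
    (hβ : IsCongruence L A β) (hδ : IsCongruence L A δ)
    (hC : Centralizes L A β β δ) :
    Centralizes L A (RelComp (RelComp δ β) δ) (RelComp (RelComp δ β) δ) δ := by
  obtain ⟨⟨-, hsymm, hcomp⟩, htrans⟩ := hδ
  intro n t a b ⟨b', ⟨a', haa', hab'⟩, hbb'⟩ u v huv h
  choose v' hv hvv' using huv
  choose u' huu' huv' using hv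
  have key : ∀ {c d : A} {p q : Fin n → A}, δ c d → (∀ i, δ (p i) (q i)) →
      δ (t.realize (Fin.cons c p)) (t.realize (Fin.cons d q)) := fun hcd hpq =>
    hcomp.realize t (Fin.cases hcd hpq)
  have h' : δ (t.realize (Fin.cons a' u')) (t.realize (Fin.cons a' v')) :=
    htrans (hsymm (key haa' huu')) (htrans h (key haa' fun i => hsymm (hvv' i)))
  exact htrans (key (hsymm hbb') huu')
    (htrans (hC n t a' b' hab' u' v' huv' h') (key hbb' hvv'))
end
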